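/- For every μ > 0, every a > 0, every r ∈ S² and every constant vector c ∈ ℝ³, the single-layer potential of the rescaled Stokeslet applied to the constant density c satisfies ∫_{S²} G(a(r − s)) c dσ(s) = (2/(3μa)) c. (Equivalently: translations are eigenfunctions of the single-layer operator f ↦ ∫_{S²} G(a(· − s)) f(s) dσ(s) with eigenvalue 2/(3μa), i.e. eigenvalue 3μa/2 for its inverse; this is the fact underlying the Stokes drag formula 6πμa.) -/

import Mathlib

open MeasureTheory Metric

/-- The Stokeslet `G(r) = (1/(8πμ))(Id/|r| + r⊗r/|r|³)` as a 3×3 matrix, on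
`EuclideanSpace ℝ (Fin 3)` (so `‖·‖` is the Euclidean norm). -/
noncomputable def stokeslet (μ : ℝ) (r : EuclideanSpace ℝ (Fin 3)) :
    Matrix (Fin 3) (Fin 3) ℝ :=
  fun i j => (1 / (8 * Real.pi * μ)) *
    ((if i = j then (1 : ℝ) else 0) / ‖r‖ + r i * r j / ‖r‖ ^ 3)

/-- The surface measure `σ` on the unit sphere `S² ⊆ ℝ³` (total mass `4π`). -/
noncomputable def sphereMeasure : Measure (sphere (0 : EuclideanSpace ℝ (Fin 3)) 1) :=
  (volume : Measure (EuclideanSpace ℝ (Fin 3))).toSphere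

lemma disc_map : Measure.map (fun y : EuclideanSpace ℝ (Fin 2) => ‖y‖ ^ 2) volume
    = ENNReal.ofReal Real.pi • (volume : Measure ℝ).restrict (Set.Ici 0) := by
  have hm : Measurable (fun y : EuclideanSpace ℝ (Fin 2) => ‖y‖ ^ 2) := by fun_prop
  have key : ∀ b : ℝ, volume ((fun y : EuclideanSpace ℝ (Fin 2) => ‖y‖ ^ 2) ⁻¹' Set.Iio b)
      = ENNReal.ofReal Real.pi * ENNReal.ofReal b := by
    intro b
    rcases le_or_gt b 0 with hb | hb
    · rw [ENNReal.ofReal_of_nonpos hb, mul_zero]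
      convert measure_empty (μ := (volume : Measure (EuclideanSpace ℝ (Fin 2))))
      ext y
      simp only [Set.mem_preimage, Set.mem_Iio, Set.mem_empty_iff_false, iff_false, not_lt]
      exact hb.trans (sq_nonneg _)
    · have : ((fun y : EuclideanSpace ℝ (Fin 2) => ‖y‖ ^ 2) ⁻¹' Set.Iio b) = ball 0 (√b) := by
        ext y
        simp [Real.lt_sqrt (norm_nonneg y)]
      rw [this, EuclideanSpace.volume_ball_fin_two, ← ENNReal.ofReal_pow (Real.sqrt_nonneg _),
        Real.sq_sqrt hb.le, mul_comm]
  have key2 : ∀ b : ℝ, (Measure.map (fun y : EuclideanSpace ℝ (Fin 2) => ‖y‖ ^ 2) volume) (Set.Iio b)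
      = ENNReal.ofReal Real.pi * ENNReal.ofReal b := by
    intro b; rw [Measure.map_apply hm measurableSet_Iio, key]
  have key3 : ∀ ⦃a b : ℝ⦄, a < b → (Measure.map (fun y : EuclideanSpace ℝ (Fin 2) => ‖y‖ ^ 2) volume)
      (Set.Ico a b) = ENNReal.ofReal Real.pi * (ENNReal.ofReal b - ENNReal.ofReal a) := by
    intro a b hab
    have : Set.Ico a b = Set.Iio b \ Set.Iio a := by ext; simp
    rw [this, measure_sdiff (Set.Iio_subset_Iio hab.le) measurableSet_Iio.nullMeasurableSet, key2, key2,
      ENNReal.mul_sub (fun _ _ => ENNReal.ofReal_ne_top)]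
    rw [key2]; exact ENNReal.mul_ne_top ENNReal.ofReal_ne_top ENNReal.ofReal_ne_top
  refine Measure.ext_of_Ico' _ _ ?_ ?_
  · intro a b hab
    rw [key3 hab]
    exact ENNReal.mul_ne_top ENNReal.ofReal_ne_top (ENNReal.sub_ne_top ENNReal.ofReal_ne_top)
  · intro a b hab
    rw [key3 hab, Measure.smul_apply, Measure.restrict_apply measurableSet_Ico, smul_eq_mul]
    congr 1
    have : Set.Ico a b ∩ Set.Ici 0 = Set.Ico (max a 0) b := by
      ext; simp; try tauto
    rw [this, Real.volume_Ico]
    rcases le_total a 0 with h | h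
    · simp [h, ENNReal.ofReal_of_nonpos h]
    · rw [max_eq_left h, ENNReal.ofReal_sub _ h]

lemma half_vol (A : Set ℝ) (hA : MeasurableSet A) :
    (volume : Measure (ℝ × ℝ)) {p | p.1 ^ 2 ≤ p.2 ∧ 0 < p.2 ∧ p.2 < 1 ∧ p.1 / √p.2 ∈ A}
      = ENNReal.ofReal (2/3) * volume (A ∩ Set.Icc (-1) 1) := by
  have hm : MeasurableSet {p : ℝ × ℝ | p.1 ^ 2 ≤ p.2 ∧ 0 < p.2 ∧ p.2 < 1 ∧ p.1 / √p.2 ∈ A} := by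
    refine MeasurableSet.inter (measurableSet_le (f := fun p : ℝ × ℝ => p.1 ^ 2) (g := fun p => p.2) (by fun_prop) (by fun_prop))
      (MeasurableSet.inter (measurableSet_lt (f := fun _ : ℝ × ℝ => (0:ℝ)) (g := fun p => p.2) (by fun_prop) (by fun_prop))
      (MeasurableSet.inter (measurableSet_lt (f := fun p : ℝ × ℝ => p.2) (g := fun _ => (1:ℝ)) (by fun_prop) (by fun_prop)) ?_))
    exact (show Measurable (fun p : ℝ × ℝ => p.1 / √p.2) by fun_prop) hA
  rw [Measure.volume_eq_prod, Measure.prod_apply_symm hm]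
  have h1 : ∀ v : ℝ, volume ((fun x : ℝ => (x, v)) ⁻¹'
      {p : ℝ × ℝ | p.1 ^ 2 ≤ p.2 ∧ 0 < p.2 ∧ p.2 < 1 ∧ p.1 / √p.2 ∈ A})
      = (Set.Ioo (0:ℝ) 1).indicator (fun v => ENNReal.ofReal (√v) * volume (A ∩ Set.Icc (-1) 1)) v := by
    intro v
    by_cases hv : v ∈ Set.Ioo (0:ℝ) 1
    · rw [Set.indicator_of_mem hv]
      have hs : 0 < √v := Real.sqrt_pos.2 hv.1
      have : ((fun x : ℝ => (x, v)) ⁻¹'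
        {p : ℝ × ℝ | p.1 ^ 2 ≤ p.2 ∧ 0 < p.2 ∧ p.2 < 1 ∧ p.1 / √p.2 ∈ A})
          = (fun x => (√v)⁻¹ * x) ⁻¹' (A ∩ Set.Icc (-1) 1) := by
        ext x
        simp only [Set.mem_preimage, Set.mem_ofPred_eq, Set.mem_inter_iff, Set.mem_Icc,
          ← abs_le, abs_mul, abs_inv, abs_of_pos hs]
        rw [inv_mul_le_iff₀ hs, mul_one, ← Real.sqrt_sq_eq_abs, Real.sqrt_le_sqrt_iff hv.1.le,
          inv_mul_eq_div]
        have := hv.1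
        have := hv.2
        tauto
      rw [this, Real.volume_preimage_mul_left (inv_ne_zero hs.ne'), inv_inv, abs_of_pos hs]
    · rw [Set.indicator_of_notMem hv]
      convert measure_empty (μ := (volume : Measure ℝ))
      ext x
      simp only [Set.mem_preimage, Set.mem_ofPred_eq, Set.mem_empty_iff_false, iff_false]
      rintro ⟨_, h2, h3, _⟩
      exact hv ⟨h2, h3⟩
  simp_rw [h1]
  rw [lintegral_indicator measurableSet_Ioo, lintegral_mul_const _ (by fun_prop)]
  congr 1
  rw [← ofReal_integral_eq_lintegral_ofReal]
  · congr 1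
    rw [← integral_Ioc_eq_integral_Ioo, ← intervalIntegral.integral_of_le zero_le_one]
    simp_rw [Real.sqrt_eq_rpow]
    rw [integral_rpow (by norm_num)]
    norm_num
  · have : IntegrableOn (fun v : ℝ => √v) (Set.Icc 0 1) :=
      (Real.continuous_sqrt.continuousOn).integrableOn_compact isCompact_Icc
    exact this.mono_set Set.Ioo_subset_Icc_self
  · exact Filter.Eventually.of_forall fun v => Real.sqrt_nonneg v

lemma cyl_vol (A : Set ℝ) (hA : MeasurableSet A) :
    (volume : Measure (ℝ × EuclideanSpace ℝ (Fin 2)))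
      {p | 0 < p.1 ^ 2 + ‖p.2‖ ^ 2 ∧ p.1 ^ 2 + ‖p.2‖ ^ 2 < 1 ∧ p.1 / √(p.1 ^ 2 + ‖p.2‖ ^ 2) ∈ A}
      = ENNReal.ofReal Real.pi * (ENNReal.ofReal (2/3) * volume (A ∩ Set.Icc (-1) 1)) := by
  have hm : MeasurableSet {p : ℝ × EuclideanSpace ℝ (Fin 2) | 0 < p.1 ^ 2 + ‖p.2‖ ^ 2 ∧
      p.1 ^ 2 + ‖p.2‖ ^ 2 < 1 ∧ p.1 / √(p.1 ^ 2 + ‖p.2‖ ^ 2) ∈ A} := by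
    refine (MeasurableSet.inter (measurableSet_lt (f := fun _ : ℝ × EuclideanSpace ℝ (Fin 2) => (0:ℝ)) (g := fun p => p.1 ^ 2 + ‖p.2‖ ^ 2) (by fun_prop) (by fun_prop))
      (MeasurableSet.inter (measurableSet_lt (f := fun p : ℝ × EuclideanSpace ℝ (Fin 2) => p.1 ^ 2 + ‖p.2‖ ^ 2) (g := fun _ => (1:ℝ)) (by fun_prop) (by fun_prop)) ?_))
    exact (show Measurable (fun p : ℝ × EuclideanSpace ℝ (Fin 2) =>
      p.1 / √(p.1 ^ 2 + ‖p.2‖ ^ 2)) by fun_prop) hA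
  have hm2 : MeasurableSet {p : ℝ × ℝ | p.1 ^ 2 ≤ p.2 ∧ 0 < p.2 ∧ p.2 < 1 ∧ p.1 / √p.2 ∈ A} := by
    refine MeasurableSet.inter (measurableSet_le (f := fun p : ℝ × ℝ => p.1 ^ 2) (g := fun p => p.2) (by fun_prop) (by fun_prop))
      (MeasurableSet.inter (measurableSet_lt (f := fun _ : ℝ × ℝ => (0:ℝ)) (g := fun p => p.2) (by fun_prop) (by fun_prop))
      (MeasurableSet.inter (measurableSet_lt (f := fun p : ℝ × ℝ => p.2) (g := fun _ => (1:ℝ)) (by fun_prop) (by fun_prop)) ?_))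
    exact (show Measurable (fun p : ℝ × ℝ => p.1 / √p.2) by fun_prop) hA
  rw [← half_vol A hA, Measure.volume_eq_prod, Measure.volume_eq_prod, Measure.prod_apply hm,
    Measure.prod_apply hm2, ← lintegral_const_mul _ (measurable_measure_prodMk_left hm2)]
  refine lintegral_congr fun z => ?_
  have hB : MeasurableSet {w : ℝ | 0 < z ^ 2 + w ∧ z ^ 2 + w < 1 ∧ z / √(z ^ 2 + w) ∈ A} := by
    refine (MeasurableSet.inter (measurableSet_lt (f := fun _ : ℝ => (0:ℝ)) (g := fun p => z ^ 2 + p) (by fun_prop) (by fun_prop))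
      (MeasurableSet.inter (measurableSet_lt (f := fun p : ℝ => z ^ 2 + p) (g := fun _ => (1:ℝ)) (by fun_prop) (by fun_prop)) ?_))
    exact (show Measurable (fun w : ℝ => z / √(z ^ 2 + w)) by fun_prop) hA
  have h1 := Measure.map_apply (μ := volume)
    (show Measurable (fun y : EuclideanSpace ℝ (Fin 2) => ‖y‖ ^ 2) by fun_prop) hB
  rw [disc_map, Measure.smul_apply, Measure.restrict_apply hB, smul_eq_mul] at h1
  refine Eq.trans h1.symm ?_
  congr 1
  rw [← measure_preimage_add volume (z ^ 2) (Prod.mk z ⁻¹' _)]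
  congr 1
  ext w
  simp
  tauto

open scoped Pointwise in
lemma cone_eq (s : Set (sphere (0 : EuclideanSpace ℝ (Fin 3)) 1)) :
    Set.Ioo (0 : ℝ) 1 • ((↑) '' s : Set (EuclideanSpace ℝ (Fin 3)))
      = {x | 0 < ‖x‖ ∧ ‖x‖ < 1 ∧ ‖x‖⁻¹ • x ∈ ((↑) '' s : Set (EuclideanSpace ℝ (Fin 3)))} := by
  ext x
  simp only [Set.mem_smul, Set.mem_ofPred_eq]
  constructor
  · rintro ⟨t, ht, y, ⟨y, hy, rfl⟩, rfl⟩
    have hn : ‖(y : EuclideanSpace ℝ (Fin 3))‖ = 1 := by simp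
    have : ‖t • (y : EuclideanSpace ℝ (Fin 3))‖ = t := by
      rw [norm_smul, hn, mul_one, Real.norm_eq_abs, abs_of_pos ht.1]
    rw [this]
    refine ⟨ht.1, ht.2, y, hy, ?_⟩
    rw [smul_smul, inv_mul_cancel₀ ht.1.ne', one_smul]
  · rintro ⟨h1, h2, h3⟩
    exact ⟨‖x‖, ⟨h1, h2⟩, _, h3, by rw [smul_smul, mul_inv_cancel₀ h1.ne', one_smul]⟩

noncomputable def sphMap (L : EuclideanSpace ℝ (Fin 3) ≃ₗᵢ[ℝ] EuclideanSpace ℝ (Fin 3))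
    (s : sphere (0 : EuclideanSpace ℝ (Fin 3)) 1) : sphere (0 : EuclideanSpace ℝ (Fin 3)) 1 :=
  ⟨L s, by simp⟩

lemma sphMap_mp (L : EuclideanSpace ℝ (Fin 3) ≃ₗᵢ[ℝ] EuclideanSpace ℝ (Fin 3)) :
    MeasurePreserving (sphMap L) sphereMeasure sphereMeasure := by
  have hm : Measurable (sphMap L) :=
    ((L.continuous.comp continuous_subtype_val).subtype_mk _).measurable
  refine ⟨hm, ?_⟩
  ext s hs
  rw [Measure.map_apply hm hs, sphereMeasure, Measure.toSphere_apply' _ hs,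
    Measure.toSphere_apply' _ (hm hs), cone_eq, cone_eq]
  conv_rhs => rw [← L.measurePreserving.measure_preimage_emb L.toHomeomorph.measurableEmbedding]
  congr 2
  ext x
  simp only [Set.mem_preimage, Set.mem_ofPred_eq, LinearIsometryEquiv.norm_map, Set.mem_image]
  refine and_congr Iff.rfl (and_congr Iff.rfl ⟨?_, ?_⟩)
  · rintro ⟨y, hy, h⟩
    exact ⟨_, hy, by simp [sphMap, h]⟩
  · rintro ⟨y, hy, h⟩
    refine ⟨sphMap L.symm y, ?_, ?_⟩
    · convert hy
      simp [sphMap]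
    · simp [sphMap, h]

lemma sph_integral_comp (L : EuclideanSpace ℝ (Fin 3) ≃ₗᵢ[ℝ] EuclideanSpace ℝ (Fin 3))
    (F : EuclideanSpace ℝ (Fin 3) → ℝ) :
    ∫ s, F (L (s : EuclideanSpace ℝ (Fin 3))) ∂sphereMeasure
      = ∫ s, F (s : EuclideanSpace ℝ (Fin 3)) ∂sphereMeasure := by
  have hemb : MeasurableEmbedding (sphMap L) := by
    refine ((L.continuous.comp continuous_subtype_val).subtype_mk _).measurableEmbedding ?_
    intro x y h
    apply Subtype.ext
    exact L.injective (Subtype.ext_iff.1 h)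
  exact (sphMap_mp L).integral_comp hemb
    (fun s : sphere (0 : EuclideanSpace ℝ (Fin 3)) 1 => F s)

lemma archimedes (b : OrthonormalBasis (Fin 3) ℝ (EuclideanSpace ℝ (Fin 3))) :
    Measure.map (fun s : sphere (0 : EuclideanSpace ℝ (Fin 3)) 1 =>
      inner ℝ (b 0) (s : EuclideanSpace ℝ (Fin 3))) sphereMeasure
      = ENNReal.ofReal (2 * Real.pi) • (volume : Measure ℝ).restrict (Set.Icc (-1) 1) := by
  have hm : Measurable (fun s : sphere (0 : EuclideanSpace ℝ (Fin 3)) 1 =>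
      inner ℝ (b 0) (s : EuclideanSpace ℝ (Fin 3))) := by
    apply Continuous.measurable; fun_prop
  ext A hA
  rw [Measure.map_apply hm hA, sphereMeasure, Measure.toSphere_apply' _ (hm hA), cone_eq,
    Measure.smul_apply, Measure.restrict_apply hA, smul_eq_mul]
  have T1 := b.measurePreserving_repr
  have T2 := PiLp.volume_preserving_ofLp (Fin 3)
  have T3 := volume_preserving_piFinSuccAbove (fun _ : Fin 3 => ℝ) 0
  have T4 := (MeasurePreserving.id (volume : Measure ℝ)).prod (PiLp.volume_preserving_toLp (Fin 2))
  have T := T4.comp (T3.comp (T2.comp T1))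
  have hS : MeasurableSet {p : ℝ × EuclideanSpace ℝ (Fin 2) | 0 < p.1 ^ 2 + ‖p.2‖ ^ 2 ∧
      p.1 ^ 2 + ‖p.2‖ ^ 2 < 1 ∧ p.1 / √(p.1 ^ 2 + ‖p.2‖ ^ 2) ∈ A} := by
    refine (MeasurableSet.inter (measurableSet_lt (f := fun _ : ℝ × EuclideanSpace ℝ (Fin 2) => (0:ℝ)) (g := fun p => p.1 ^ 2 + ‖p.2‖ ^ 2) (by fun_prop) (by fun_prop))
      (MeasurableSet.inter (measurableSet_lt (f := fun p : ℝ × EuclideanSpace ℝ (Fin 2) => p.1 ^ 2 + ‖p.2‖ ^ 2) (g := fun _ => (1:ℝ)) (by fun_prop) (by fun_prop)) ?_))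
    exact (show Measurable (fun p : ℝ × EuclideanSpace ℝ (Fin 2) =>
      p.1 / √(p.1 ^ 2 + ‖p.2‖ ^ 2)) by fun_prop) hA
  have hv := T.measure_preimage hS.nullMeasurableSet
  rw [← Measure.volume_eq_prod, cyl_vol A hA] at hv
  have hset : {x : EuclideanSpace ℝ (Fin 3) | 0 < ‖x‖ ∧ ‖x‖ < 1 ∧ ‖x‖⁻¹ • x ∈ ((↑) '' (
      (fun s : sphere (0 : EuclideanSpace ℝ (Fin 3)) 1 =>
      inner ℝ (b 0) (s : EuclideanSpace ℝ (Fin 3))) ⁻¹' A) : Set (EuclideanSpace ℝ (Fin 3)))}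
      = (Prod.map id (WithLp.toLp 2) ∘ (MeasurableEquiv.piFinSuccAbove (fun _ : Fin 3 => ℝ) 0) ∘
        WithLp.ofLp ∘ b.repr) ⁻¹' {p : ℝ × EuclideanSpace ℝ (Fin 2) | 0 < p.1 ^ 2 + ‖p.2‖ ^ 2 ∧
      p.1 ^ 2 + ‖p.2‖ ^ 2 < 1 ∧ p.1 / √(p.1 ^ 2 + ‖p.2‖ ^ 2) ∈ A} := by
    ext x
    have hz : ((Prod.map id (WithLp.toLp 2) ∘ (MeasurableEquiv.piFinSuccAbove (fun _ : Fin 3 => ℝ) 0) ∘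
        WithLp.ofLp ∘ b.repr) x).1 = inner ℝ (b 0) x := by
      simp [MeasurableEquiv.piFinSuccAbove, b.repr_apply_apply]
    have hy : ‖((Prod.map id (WithLp.toLp 2) ∘ (MeasurableEquiv.piFinSuccAbove (fun _ : Fin 3 => ℝ) 0) ∘
        WithLp.ofLp ∘ b.repr) x).2‖ ^ 2 = inner ℝ (b 1) x ^ 2 + inner ℝ (b 2) x ^ 2 := by
      rw [EuclideanSpace.norm_sq_eq]
      simp [MeasurableEquiv.piFinSuccAbove, b.repr_apply_apply, Fin.sum_univ_two, Fin.tail]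
    have hx : ‖x‖ ^ 2 = inner ℝ (b 0) x ^ 2 + (inner ℝ (b 1) x ^ 2 + inner ℝ (b 2) x ^ 2) := by
      rw [← b.repr.norm_map, EuclideanSpace.norm_sq_eq]
      simp [Fin.sum_univ_three, b.repr_apply_apply, add_assoc]
    simp only [Set.mem_preimage, Set.mem_ofPred_eq]
    rw [hz, hy, ← hx, Real.sqrt_sq (norm_nonneg _)]
    by_cases h0 : 0 < ‖x‖
    · refine and_congr (by simp [h0]) (and_congr (by rw [sq_lt_one_iff₀ (norm_nonneg _)]) ?_)
      simp only [Set.mem_image, Set.mem_preimage]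
      constructor
      · rintro ⟨y, hy, h⟩
        rw [h, inner_smul_right, inv_mul_eq_div] at hy
        exact hy
      · intro h
        refine ⟨⟨‖x‖⁻¹ • x, by simp [norm_smul, h0.ne']⟩, ?_, rfl⟩
        rw [inner_smul_right, inv_mul_eq_div]
        exact h
    · have : ‖x‖ = 0 := le_antisymm (not_lt.1 h0) (norm_nonneg _)
      simp [this]
  rw [hset]
  refine Eq.trans (congrArg _ hv) ?_
  rw [← mul_assoc, ← mul_assoc, ← ENNReal.ofReal_natCast, ← ENNReal.ofReal_mul (by positivity),
    ← ENNReal.ofReal_mul (by positivity)]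
  congr 2
  simp
  ring

lemma rpow_int (p : ℝ) (hp : -1 < p) :
    ∫ t in Set.Icc (-1 : ℝ) 1, (2 - 2 * t) ^ p = 2⁻¹ * (4 ^ (p + 1) / (p + 1)) := by
  rw [integral_Icc_eq_integral_Ioc, ← intervalIntegral.integral_of_le (by norm_num),
    intervalIntegral.integral_comp_sub_mul (fun x : ℝ => x ^ p) two_ne_zero,
    integral_rpow (Or.inl hp)]
  norm_num [Real.zero_rpow (by linarith : p + 1 ≠ 0)]

lemma norm_pow_int (b : OrthonormalBasis (Fin 3) ℝ (EuclideanSpace ℝ (Fin 3))) (p : ℝ)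
    (hp : -1 < p) :
    ∫ s, (2 - 2 * inner ℝ (b 0) ((s : sphere (0 : EuclideanSpace ℝ (Fin 3)) 1) :
      EuclideanSpace ℝ (Fin 3))) ^ p ∂sphereMeasure
      = 2 * Real.pi * (2⁻¹ * (4 ^ (p + 1) / (p + 1))) := by
  have hm : Measurable (fun s : sphere (0 : EuclideanSpace ℝ (Fin 3)) 1 =>
      inner ℝ (b 0) (s : EuclideanSpace ℝ (Fin 3))) := by
    apply Continuous.measurable; fun_prop
  have hg : Measurable (fun t : ℝ => (2 - 2 * t) ^ p) := by fun_prop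
  have := integral_map (μ := sphereMeasure) hm.aemeasurable
    (f := fun t : ℝ => (2 - 2 * t) ^ p) hg.aestronglyMeasurable
  rw [← this, archimedes, integral_smul_measure, rpow_int p hp,
    ENNReal.toReal_ofReal (by positivity), smul_eq_mul]

lemma norm_sub_eq (r : EuclideanSpace ℝ (Fin 3)) (hr : ‖r‖ = 1)
    (s : sphere (0 : EuclideanSpace ℝ (Fin 3)) 1) :
    ‖r - s‖ ^ 2 = 2 - 2 * inner ℝ r (s : EuclideanSpace ℝ (Fin 3)) := by
  have hs : ‖(s : EuclideanSpace ℝ (Fin 3))‖ = 1 := by simp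
  rw [norm_sub_sq_real, hr, hs]; ring

lemma int_norm (b : OrthonormalBasis (Fin 3) ℝ (EuclideanSpace ℝ (Fin 3))) :
    ∫ s : sphere (0 : EuclideanSpace ℝ (Fin 3)) 1, ‖b 0 - s‖ ∂sphereMeasure
      = 16 * Real.pi / 3 := by
  have h := norm_pow_int b (1/2) (by norm_num)
  simp_rw [← norm_sub_eq _ (b.norm_eq_one 0), ← Real.sqrt_eq_rpow, Real.sqrt_sq (norm_nonneg _)] at h
  rw [h]
  have : (4:ℝ) ^ ((1:ℝ)/2 + 1) = 8 := by
    rw [show (4:ℝ) = 2 ^ (2:ℝ) by norm_num, ← Real.rpow_mul (by norm_num)]; norm_num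
  rw [this]; ring

lemma int_inv (b : OrthonormalBasis (Fin 3) ℝ (EuclideanSpace ℝ (Fin 3))) :
    ∫ s : sphere (0 : EuclideanSpace ℝ (Fin 3)) 1, ‖b 0 - s‖⁻¹ ∂sphereMeasure
      = 4 * Real.pi := by
  have h := norm_pow_int b (-(1/2)) (by norm_num)
  have e : ∀ x : ℝ, 0 ≤ x → (x ^ 2) ^ (-(1/2) : ℝ) = x⁻¹ := by
    intro x hx
    rw [Real.rpow_neg (by positivity), ← Real.sqrt_eq_rpow, Real.sqrt_sq hx]
  simp_rw [← norm_sub_eq _ (b.norm_eq_one 0), e _ (norm_nonneg _)] at h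
  rw [h]
  have : (4:ℝ) ^ (-((1:ℝ)/2) + 1) = 2 := by
    rw [show (4:ℝ) = 2 ^ (2:ℝ) by norm_num, ← Real.rpow_mul (by norm_num)]; norm_num
  rw [this]; ring

lemma integrable_inv (b : OrthonormalBasis (Fin 3) ℝ (EuclideanSpace ℝ (Fin 3))) :
    Integrable (fun s : sphere (0 : EuclideanSpace ℝ (Fin 3)) 1 => ‖b 0 - s‖⁻¹) sphereMeasure := by
  by_contra h
  have := int_inv b
  rw [integral_undef h] at this
  have := Real.pi_pos
  linarith

lemma integrable_K (b : OrthonormalBasis (Fin 3) ℝ (EuclideanSpace ℝ (Fin 3)))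
    (u v : EuclideanSpace ℝ (Fin 3)) :
    Integrable (fun s : sphere (0 : EuclideanSpace ℝ (Fin 3)) 1 =>
      inner ℝ u (b 0 - s) * inner ℝ v (b 0 - s) / ‖b 0 - s‖ ^ 3) sphereMeasure := by
  refine ((integrable_inv b).const_mul (‖u‖ * ‖v‖)).mono' ?_ ?_
  · apply Measurable.aestronglyMeasurable
    have h1 : ∀ w : EuclideanSpace ℝ (Fin 3),
        Measurable fun s : sphere (0 : EuclideanSpace ℝ (Fin 3)) 1 => inner ℝ w (b 0 - s) := by
      intro w; apply Continuous.measurable; fun_prop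
    have h2 : Measurable fun s : sphere (0 : EuclideanSpace ℝ (Fin 3)) 1 => ‖b 0 - s‖ ^ 3 := by
      apply Continuous.measurable; fun_prop
    exact ((h1 u).mul (h1 v)).div h2
  · refine Filter.Eventually.of_forall fun s => ?_
    set d := b 0 - (s : EuclideanSpace ℝ (Fin 3))
    rw [norm_div, norm_mul, norm_pow, norm_norm]
    rcases eq_or_ne d 0 with h | h
    · simp [h]
    · have hd : 0 < ‖d‖ := norm_pos_iff.2 h
      rw [div_le_iff₀ (by positivity)]
      calc ‖inner ℝ u d‖ * ‖inner ℝ v d‖ ≤ (‖u‖ * ‖d‖) * (‖v‖ * ‖d‖) := by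
            gcongr <;> exact norm_inner_le_norm _ _
        _ = _ := by field_simp

noncomputable def bil (r u v : EuclideanSpace ℝ (Fin 3)) : ℝ :=
  ∫ s : sphere (0 : EuclideanSpace ℝ (Fin 3)) 1,
      inner ℝ u (r - s) * inner ℝ v (r - s) / ‖r - s‖ ^ 3 ∂sphereMeasure

lemma bil_map (r u v : EuclideanSpace ℝ (Fin 3))
    (L : EuclideanSpace ℝ (Fin 3) ≃ₗᵢ[ℝ] EuclideanSpace ℝ (Fin 3)) (hL : L r = r) :
    bil r (L u) (L v) = bil r u v := by
  have := sph_integral_comp L (fun x => inner ℝ (L u) (r - x) * inner ℝ (L v) (r - x) / ‖r - x‖ ^ 3)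
  unfold bil
  rw [← this]
  refine integral_congr_ae (Filter.Eventually.of_forall fun s => ?_)
  have h : r - L s = L (r - s) := by rw [map_sub, hL]
  simp only [h, LinearIsometryEquiv.inner_map_map, LinearIsometryEquiv.norm_map]

lemma bil_comm (r u v : EuclideanSpace ℝ (Fin 3)) : bil r u v = bil r v u := by
  unfold bil
  simp_rw [mul_comm]

lemma bil_zero (r u v : EuclideanSpace ℝ (Fin 3)) (hur : inner ℝ u r = 0) (huv : inner ℝ u v = 0) :
    bil r u v = 0 := by
  have h := bil_map r u v (Submodule.reflection (Submodule.span ℝ {u})ᗮ)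
    (Submodule.reflection_mem_subspace_eq_self (Submodule.mem_orthogonal_singleton_iff_inner_right.2 hur))
  rw [Submodule.reflection_orthogonalComplement_singleton_eq_neg,
    Submodule.reflection_mem_subspace_eq_self
      (Submodule.mem_orthogonal_singleton_iff_inner_right.2 huv)] at h
  have h2 : bil r (-u) v = - bil r u v := by
    unfold bil
    rw [← integral_neg]
    simp_rw [inner_neg_left, neg_mul, neg_div]
  linarith

lemma bil_basis (b : OrthonormalBasis (Fin 3) ℝ (EuclideanSpace ℝ (Fin 3))) (k l : Fin 3) :
    bil (b 0) (b k) (b l) = if k = l then 4 * Real.pi / 3 else 0 := by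
  have hoff : ∀ k l : Fin 3, k ≠ 0 → k ≠ l → bil (b 0) (b k) (b l) = 0 := fun k l h0 hl =>
    bil_zero _ _ _ (b.inner_eq_zero h0) (b.inner_eq_zero hl)
  have h12 : bil (b 0) (b 1) (b 1) = bil (b 0) (b 2) (b 2) := by
    have := bil_map (b 0) (b 2) (b 2) (b.equiv b (Equiv.swap 1 2)) (by
      rw [OrthonormalBasis.equiv_apply_basis]; rfl)
    rw [OrthonormalBasis.equiv_apply_basis] at this
    simpa using this
  have h00 : bil (b 0) (b 0) (b 0) = 4 * Real.pi / 3 := by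
    have : bil (b 0) (b 0) (b 0)
        = ∫ s : sphere (0 : EuclideanSpace ℝ (Fin 3)) 1, 4⁻¹ * ‖b 0 - s‖ ∂sphereMeasure := by
      refine integral_congr_ae (Filter.Eventually.of_forall fun s => ?_)
      have h1 := norm_sub_eq (b 0) (b.norm_eq_one 0) s
      have h2 : inner ℝ (b 0) (b 0 - (s : EuclideanSpace ℝ (Fin 3))) = ‖b 0 - s‖ ^ 2 / 2 := by
        rw [h1, inner_sub_right, real_inner_self_eq_norm_sq, b.norm_eq_one]; ring
      simp only [h2]
      rcases eq_or_ne ‖b 0 - (s : EuclideanSpace ℝ (Fin 3))‖ 0 with h | h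
      · simp [h]
      · field_simp; try norm_num
    rw [this, integral_const_mul, int_norm]; ring
  have htr : bil (b 0) (b 0) (b 0) + bil (b 0) (b 1) (b 1) + bil (b 0) (b 2) (b 2)
      = 4 * Real.pi := by
    rw [← int_inv b]
    unfold bil
    rw [← integral_add (integrable_K b _ _) (integrable_K b _ _),
      ← integral_add ((integrable_K b _ _).fun_add (integrable_K b _ _)) (integrable_K b _ _)]
    refine integral_congr_ae (Filter.Eventually.of_forall fun s => ?_)
    have hx : ∀ x : EuclideanSpace ℝ (Fin 3),
        inner ℝ (b 0) x * inner ℝ (b 0) x + inner ℝ (b 1) x * inner ℝ (b 1) x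
          + inner ℝ (b 2) x * inner ℝ (b 2) x = ‖x‖ ^ 2 := by
      intro x
      rw [← b.repr.norm_map, EuclideanSpace.norm_sq_eq]
      simp [Fin.sum_univ_three, b.repr_apply_apply, sq]
    simp only []
    rw [← add_div, ← add_div, hx]
    rcases eq_or_ne ‖b 0 - (s : EuclideanSpace ℝ (Fin 3))‖ 0 with h | h
    · simp [h]
    · field_simp
  split_ifs with h
  · subst h
    fin_cases k
    · exact h00
    · show bil (b 0) (b 1) (b 1) = _
      linarith
    · show bil (b 0) (b 2) (b 2) = _
      linarith
  · by_cases hk : k = 0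
    · rw [bil_comm]
      exact hoff l k (fun hl => h (hk.trans hl.symm)) (Ne.symm h)
    · exact hoff k l hk h

lemma bil_eq (b : OrthonormalBasis (Fin 3) ℝ (EuclideanSpace ℝ (Fin 3)))
    (u v : EuclideanSpace ℝ (Fin 3)) :
    bil (b 0) u v = 4 * Real.pi / 3 * inner ℝ u v := by
  have h : bil (b 0) u v = ∑ k, ∑ l, (inner ℝ u (b k) * inner ℝ v (b l)) * bil (b 0) (b k) (b l) := by
    unfold bil
    simp_rw [← integral_const_mul]
    simp_rw [← integral_finsetSum Finset.univ
      (fun l _ => (integrable_K b _ (b l)).const_mul _)]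
    rw [← integral_finsetSum Finset.univ (fun k _ => integrable_finsetSum _
      (fun l _ => (integrable_K b _ (b l)).const_mul _))]
    refine integral_congr_ae (Filter.Eventually.of_forall fun s => ?_)
    simp only
    rw [← b.sum_inner_mul_inner u, ← b.sum_inner_mul_inner v, Finset.sum_mul_sum, Finset.sum_div]
    refine Finset.sum_congr rfl fun k _ => ?_
    rw [Finset.sum_div]
    refine Finset.sum_congr rfl fun l _ => ?_
    ring
  rw [h, ← b.sum_inner_mul_inner u v, Finset.mul_sum]
  refine Finset.sum_congr rfl fun k _ => ?_
  simp_rw [bil_basis]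
  simp only [mul_ite, mul_zero, Finset.sum_ite_eq, Finset.mem_univ, if_true]
  rw [real_inner_comm v (b k)]
  ring

/-- Translations are eigenfunctions of the single-layer operator of the rescaled
Stokeslet: for `μ > 0`, `a > 0`, `r ∈ S²` and a constant vector `c ∈ ℝ³`,
`∫_{S²} G(a(r − s)) c dσ(s) = (2/(3μa)) c`. -/
theorem single_layer_constant_eigenfunction (μ : ℝ) (hμ : 0 < μ) (a : ℝ) (ha : 0 < a)
    (r : EuclideanSpace ℝ (Fin 3)) (hr : ‖r‖ = 1) (c : Fin 3 → ℝ) :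
    (∫ s : sphere (0 : EuclideanSpace ℝ (Fin 3)) 1,
        (stokeslet μ (a • (r - (s : EuclideanSpace ℝ (Fin 3))))).mulVec c ∂sphereMeasure)
      = (2 / (3 * μ * a)) • c := by
  obtain ⟨b, hb⟩ : ∃ b : OrthonormalBasis (Fin 3) ℝ (EuclideanSpace ℝ (Fin 3)), b 0 = r := by
    have ho : Orthonormal ℝ (({0} : Set (Fin 3)).domRestrict (fun _ : Fin 3 => r)) :=
      ⟨fun _ => hr, fun i j hij => absurd (Subsingleton.elim i j) hij⟩
    obtain ⟨b, hb⟩ := ho.exists_orthonormalBasis_extension_of_card_eq (by simp)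
    exact ⟨b, hb 0 rfl⟩
  subst hb
  have hpt : ∀ (i : Fin 3) (s : sphere (0 : EuclideanSpace ℝ (Fin 3)) 1),
      (stokeslet μ (a • (b 0 - (s : EuclideanSpace ℝ (Fin 3))))).mulVec c i
      = (1 / (8 * Real.pi * μ * a)) * (c i * ‖b 0 - (s : EuclideanSpace ℝ (Fin 3))‖⁻¹
        + inner ℝ (EuclideanSpace.single i (1:ℝ)) (b 0 - (s : EuclideanSpace ℝ (Fin 3)))
          * inner ℝ (WithLp.toLp 2 c) (b 0 - (s : EuclideanSpace ℝ (Fin 3)))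
          / ‖b 0 - (s : EuclideanSpace ℝ (Fin 3))‖ ^ 3) := by
    intro i s
    generalize b 0 - (s : EuclideanSpace ℝ (Fin 3)) = d
    have e1 : inner ℝ (EuclideanSpace.single i (1:ℝ)) d = d i := by simp [EuclideanSpace.inner_single_left]
    have e2 : inner ℝ (WithLp.toLp 2 c) d = ∑ j, c j * d j := by
      simp [PiLp.inner_apply, mul_comm]
    rw [e1, e2]
    simp only [Matrix.mulVec, dotProduct, stokeslet, norm_smul, Real.norm_eq_abs, abs_of_pos ha,
      PiLp.smul_apply, smul_eq_mul]
    have e3 : c i = ∑ j, (if i = j then (1:ℝ) else 0) * c j := by simp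
    rw [e3, Finset.sum_mul, Finset.mul_sum, Finset.sum_div, ← Finset.sum_add_distrib,
      Finset.mul_sum]
    refine Finset.sum_congr rfl fun j _ => ?_
    have hpi := Real.pi_pos
    rcases eq_or_ne ‖d‖ 0 with h | h
    · simp [h]
    · field_simp
  have hInt : ∀ i : Fin 3, Integrable (fun s : sphere (0 : EuclideanSpace ℝ (Fin 3)) 1 =>
      (stokeslet μ (a • (b 0 - (s : EuclideanSpace ℝ (Fin 3))))).mulVec c i) sphereMeasure := by
    intro i
    simp_rw [hpt]
    exact (((integrable_inv b).const_mul _).add (integrable_K b _ _)).const_mul _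
  ext i
  rw [eval_integral hInt]
  simp_rw [hpt]
  rw [integral_const_mul, integral_add ((integrable_inv b).const_mul _) (integrable_K b _ _),
    integral_const_mul, int_inv]
  have := bil_eq b (EuclideanSpace.single i (1:ℝ)) (WithLp.toLp 2 c)
  unfold bil at this
  rw [this]
  have e1 : inner ℝ (EuclideanSpace.single i (1:ℝ)) (WithLp.toLp 2 c) = c i := by simp [EuclideanSpace.inner_single_left]
  rw [e1, Pi.smul_apply, smul_eq_mul]
  have hpi := Real.pi_pos
  field_simp
  ring
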